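/- Let G be a group with a finite symmetric generating set S whose growth function satisfies γ_S(n) ≤ C·n^k for all n ≥ 1, for some constant C > 0 and k ∈ ℕ. Suppose H_0 ≤ H_1 ≤ ⋯ ≤ H_n ≤ G is a finite chain of subgroups such that for each i with 1 ≤ i ≤ n there is a group homomorphism f_i from H_i to the additive group ℝ^l which is nontrivial (i.e. f_i is not identically zero) and satisfies H_{i−1} ⊆ Ker f_i. Then n ≤ k. -/

import Mathlib

open scoped BigOperators

/-- The ball of radius `n` in a group `G` with respect to a set `S`:
elements expressible as a product of at most `n` elements of `S`. -/
def ball {G : Type*} [Group G] (S : Set G) (n : ℕ) : Set G :=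
  {g | ∃ l : List G, (∀ x ∈ l, x ∈ S) ∧ l.length ≤ n ∧ l.prod = g}

/-- The growth function of `G` relative to `S`: `γ_S(n) = |B_S(n)|`. -/
noncomputable def growth {G : Type*} [Group G] (S : Set G) (n : ℕ) : ℕ := (ball S n).ncard

/-- A finite symmetric generating set of `G`. -/
def IsSymmGen {G : Type*} [Group G] (S : Finset G) : Prop :=
  (∀ x ∈ S, x⁻¹ ∈ S) ∧ Subgroup.closure (S : Set G) = ⊤

/-- `G` has polynomial growth: for some finite symmetric generating set `S`
there are `C > 0` and `k : ℕ` with `γ_S(n) ≤ C * n ^ k` for all `n ≥ 1`. -/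
def HasPolyGrowth (G : Type*) [Group G] : Prop :=
  ∃ S : Finset G, IsSymmGen S ∧ ∃ C : ℝ, 0 < C ∧ ∃ k : ℕ,
    ∀ n : ℕ, 1 ≤ n → (growth (S : Set G) n : ℝ) ≤ C * (n : ℝ) ^ k

theorem one_mem_ball {G : Type*} [Group G] (S : Set G) (n : ℕ) : 1 ∈ ball S n :=
  ⟨[], by simp, by simp, by simp⟩

theorem ball_mono {G : Type*} [Group G] (S : Set G) {m n : ℕ} (h : m ≤ n) :
    ball S m ⊆ ball S n := by
  rintro g ⟨l, hl, hlen, rfl⟩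
  exact ⟨l, hl, hlen.trans h, rfl⟩

theorem mul_mem_ball {G : Type*} [Group G] {S : Set G} {m n : ℕ} {g h : G}
    (hg : g ∈ ball S m) (hh : h ∈ ball S n) : g * h ∈ ball S (m + n) := by
  obtain ⟨l, hl, hlen, rfl⟩ := hg
  obtain ⟨l', hl', hlen', rfl⟩ := hh
  refine ⟨l ++ l', ?_, ?_, by simp⟩
  · intro x hx
    rcases List.mem_append.1 hx with hx | hx
    exacts [hl x hx, hl' x hx]
  · rw [List.length_append]
    exact add_le_add hlen hlen'

theorem pow_mem_ball_mul {G : Type*} [Group G] {S : Set G} {r : ℕ} {g : G}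
    (hg : g ∈ ball S r) (a : ℕ) : g ^ a ∈ ball S (r * a) := by
  induction a with
  | zero => simpa using one_mem_ball S 0
  | succ a ih =>
    rw [pow_succ, Nat.mul_succ]
    exact mul_mem_ball ih hg

theorem finite_ball {G : Type*} [Group G] (S : Finset G) (n : ℕ) :
    (ball (S : Set G) n).Finite := by
  refine ((List.finite_length_le S n).image fun l => (l.map Subtype.val).prod).subset ?_
  rintro g ⟨l, hl, hlen, rfl⟩
  lift l to List S using hl
  exact ⟨l, by simpa using hlen, rfl⟩

theorem IsSymmGen.exists_mem_ball {G : Type*} [Group G] {S : Finset G} (hS : IsSymmGen S)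
    (g : G) : ∃ r, g ∈ ball (S : Set G) r := by
  have hg : g ∈ (Subgroup.closure (S : Set G)).toSubmonoid := by rw [hS.2]; trivial
  rw [Subgroup.closure_toSubmonoid] at hg
  obtain ⟨l, hl, rfl⟩ := Submonoid.exists_list_of_mem_closure hg
  refine ⟨l.length, l, fun x hx => ?_, le_rfl, rfl⟩
  rcases hl x hx with h | h
  · exact h
  · simpa using hS.1 _ h

/-- If `f` is additive on a subgroup `K`, vanishes on `T` and not at `x`, then the products
`t * x ^ a` with `t ∈ T` are pairwise distinct. -/
theorem injOn_mul_pow_of_ne_zero {G V : Type*} [Group G] [AddCommGroup V]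
    [IsAddTorsionFree V] {K : Subgroup G} (f : K → V)
    (hf : ∀ x y : K, f (x * y) = f x + f y) {T : Set G} (hTK : T ⊆ K)
    (hT : ∀ x : K, (x : G) ∈ T → f x = 0) {x : K} (hx : f x ≠ 0) :
    Set.InjOn (fun p : G × ℕ => p.1 * (x : G) ^ p.2) (T ×ˢ Set.univ) := by
  have hpow (a : ℕ) : f (x ^ a) = a • f x := by
    induction a with
    | zero => simpa using hf 1 1
    | succ a ih => rw [pow_succ, hf, ih, succ_nsmul]
  rintro ⟨t, a⟩ ⟨ht, -⟩ ⟨u, b⟩ ⟨hu, -⟩ h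
  have h' : (⟨t, hTK ht⟩ : K) * x ^ a = ⟨u, hTK hu⟩ * x ^ b := Subtype.ext h
  have hab := congrArg f h'
  rw [hf, hf, hT ⟨t, hTK ht⟩ ht, hT ⟨u, hTK hu⟩ hu, zero_add, zero_add, hpow, hpow] at hab
  obtain rfl : a = b :=
    Int.ofNat_injective (smul_left_injective ℤ hx
      (by simpa only [Int.ofNat_eq_natCast, natCast_zsmul] using hab))
  simpa using h

/-- The `i`-th subgroup of the chain contains at least `m ^ i` elements of word length `O(m)`. -/
theorem exists_finset_card_eq_pow_subset_ball {G V : Type*} [Group G] [AddCommGroup V]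
    [IsAddTorsionFree V] {S : Finset G} (hS : IsSymmGen S) {n : ℕ}
    (H : Fin (n + 1) → Subgroup G) (hmono : Monotone H) (f : ∀ i : Fin n, H i.succ → V)
    (hhom : ∀ (i : Fin n) (x y : H i.succ), f i (x * y) = f i x + f i y)
    (hnontriv : ∀ i : Fin n, ∃ x : H i.succ, f i x ≠ 0)
    (hker : ∀ (i : Fin n) (x : H i.succ), (x : G) ∈ H i.castSucc → f i x = 0)
    (i : Fin (n + 1)) :
    ∃ L : ℕ, ∀ m : ℕ, ∃ T : Finset G, T.card = m ^ (i : ℕ) ∧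
      (T : Set G) ⊆ H i ∧ (T : Set G) ⊆ ball (S : Set G) (L * m) := by
  classical
  induction i using Fin.induction with
  | zero =>
    refine ⟨0, fun m => ⟨{1}, by simp, by simp [one_mem], ?_⟩⟩
    simpa using one_mem_ball (S : Set G) 0
  | succ i ih =>
    obtain ⟨L, hL⟩ := ih
    obtain ⟨x, hx⟩ := hnontriv i
    obtain ⟨r, hr⟩ := hS.exists_mem_ball (x : G)
    refine ⟨L + r, fun m => ?_⟩
    obtain ⟨T, hcard, hTH, hTball⟩ := hL m
    have hTK : (T : Set G) ⊆ H i.succ := hTH.trans (hmono i.castSucc_lt_succ.le)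
    have hinj := injOn_mul_pow_of_ne_zero (f i) (hhom i) hTK
      (fun y hy => hker i y (hTH hy)) hx
    refine ⟨(T ×ˢ Finset.range m).image fun p => p.1 * (x : G) ^ p.2, ?_, ?_, ?_⟩
    · rw [Finset.card_image_of_injOn (hinj.mono ?_), Finset.card_product, hcard,
        Finset.card_range, Fin.val_succ, Fin.val_castSucc, pow_succ]
      rintro ⟨t, a⟩ hp
      simp only [Finset.coe_product, Set.mem_prod] at hp
      exact ⟨hp.1, trivial⟩
    · intro g hg
      obtain ⟨⟨t, a⟩, hp, rfl⟩ := Finset.mem_image.1 (Finset.mem_coe.1 hg)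
      exact mul_mem (hTK (Finset.mem_product.1 hp).1) (pow_mem x.2 a)
    · intro g hg
      obtain ⟨⟨t, a⟩, hp, rfl⟩ := Finset.mem_image.1 (Finset.mem_coe.1 hg)
      obtain ⟨ht, ha⟩ := Finset.mem_product.1 hp
      rw [add_mul]
      exact mul_mem_ball (hTball ht)
        (ball_mono _ (Nat.mul_le_mul_left r (Finset.mem_range.1 ha).le) (pow_mem_ball_mul hr a))

theorem le_of_forall_pow_le_const_mul_pow {n k : ℕ} {D : ℝ}
    (h : ∀ m : ℕ, 1 ≤ m → (m : ℝ) ^ n ≤ D * (m : ℝ) ^ k) : n ≤ k := by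
  by_contra! hkn
  obtain ⟨m, hm⟩ := exists_nat_gt (max D 1)
  have hm1 : (1 : ℝ) < m := (le_max_right _ _).trans_lt hm
  have hle := h m (by exact_mod_cast hm1.le)
  have hpow : (m : ℝ) ^ (k + 1) ≤ (m : ℝ) ^ n := pow_le_pow_right₀ hm1.le hkn
  have hlt : D * (m : ℝ) ^ k < m * (m : ℝ) ^ k :=
    mul_lt_mul_of_pos_right ((le_max_left _ _).trans_lt hm) (by positivity)
  rw [pow_succ'] at hpow
  linarith

/-- If `G` has growth function bounded by `C * n ^ k` and there is a chain of subgroups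
`H 0 ≤ H 1 ≤ ⋯ ≤ H n ≤ G` such that each `H i.succ` admits a nontrivial homomorphism to
`ℝ^l` vanishing on `H i.castSucc`, then `n ≤ k`. -/
theorem stmt1 {G : Type*} [Group G] (S : Finset G) (hS : IsSymmGen S)
    (C : ℝ) (hC : 0 < C) (k : ℕ)
    (hgrowth : ∀ n : ℕ, 1 ≤ n → (growth (S : Set G) n : ℝ) ≤ C * (n : ℝ) ^ k)
    (n l : ℕ) (H : Fin (n + 1) → Subgroup G) (hmono : Monotone H)
    (f : ∀ i : Fin n, (H i.succ) → (Fin l → ℝ))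
    (hhom : ∀ (i : Fin n) (x y : (H i.succ)), f i (x * y) = f i x + f i y)
    (hnontriv : ∀ i : Fin n, ∃ x : (H i.succ), f i x ≠ 0)
    (hker : ∀ (i : Fin n) (x : (H i.succ)), (x : G) ∈ H i.castSucc → f i x = 0) :
    n ≤ k := by
  obtain ⟨L, hL⟩ := exists_finset_card_eq_pow_subset_ball hS H hmono f hhom hnontriv hker
    (Fin.last n)
  refine le_of_forall_pow_le_const_mul_pow (D := C * ((L + 1 : ℕ) : ℝ) ^ k) fun m hm => ?_
  obtain ⟨T, hcard, -, hT⟩ := hL m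
  have hsub : (T : Set G) ⊆ ball (S : Set G) ((L + 1) * m) :=
    hT.trans (ball_mono _ (Nat.mul_le_mul_right m L.le_succ))
  have hle : m ^ n ≤ growth (S : Set G) ((L + 1) * m) := by
    have := Set.ncard_le_ncard hsub (finite_ball S _)
    rwa [Set.ncard_coe_finset, hcard, Fin.val_last] at this
  calc (m : ℝ) ^ n ≤ growth (S : Set G) ((L + 1) * m) := by exact_mod_cast hle
    _ ≤ C * (((L + 1) * m : ℕ) : ℝ) ^ k := hgrowth _ (Nat.mul_pos L.succ_pos hm)
    _ = C * ((L + 1 : ℕ) : ℝ) ^ k * (m : ℝ) ^ k := by rw [Nat.cast_mul, mul_pow, mul_assoc]
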